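/- arXiv:2101.12403 — 3 statements merged into one kernel-verified Lean document; each statement's English description precedes it below -/
import Mathlib

section
/- Suppose each C_i satisfies the (ε,δ)-lower deviation inequality and R ≤ (1−ε)Z. Then the mean-weighted allocation v = (R·μ_1/Z, …, R·μ_K/Z) has fairness Q(v) ≤ (1−ε)δ = δ − εδ. -/
open MeasureTheory ProbabilityTheory

/-- The truncated expectation of a random variable is at most the truncation level. -/
theorem integral_min_const_le {Ω : Type*} [MeasurableSpace Ω] {P : Measure Ω}
    [IsProbabilityMeasure P] {X : Ω → ℝ} (hX : Integrable X P) (v : ℝ) :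
    ∫ ω, min (X ω) v ∂P ≤ v := by
  calc ∫ ω, min (X ω) v ∂P ≤ ∫ _, v ∂P :=
        integral_mono (hX.inf (integrable_const v)) (integrable_const v)
          fun ω => min_le_right _ _
    _ = v := by simp

/-- If `X ≥ 0` exceeds `a ≥ v` outside an event of probability at most `δ`, then truncating `X`
at `v` loses at most the fraction `δ` of `v`. -/
theorem mul_one_sub_le_integral_min_const {Ω : Type*} [MeasurableSpace Ω] {P : Measure Ω}
    [IsProbabilityMeasure P] {X : Ω → ℝ} (hm : Measurable X) (hX : Integrable X P)
    (h0 : ∀ ω, 0 ≤ X ω) {v a δ : ℝ} (hv : 0 ≤ v) (hva : v ≤ a)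
    (hδ : P.real {ω | X ω ≤ a} ≤ δ) :
    v * (1 - δ) ≤ ∫ ω, min (X ω) v ∂P := by
  have hs : MeasurableSet {ω | X ω ≤ a} := measurableSet_le hm measurable_const
  have hi : Integrable ({ω | X ω ≤ a}.indicator fun _ => v) P :=
    (integrable_const v).indicator hs
  calc v * (1 - δ) ≤ v - P.real {ω | X ω ≤ a} * v := by nlinarith
    _ = ∫ ω, (v - {ω | X ω ≤ a}.indicator (fun _ => v) ω) ∂P := by
        rw [integral_sub (integrable_const v) hi, integral_indicator_const v hs]
        simp
    _ ≤ ∫ ω, min (X ω) v ∂P := by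
        refine integral_mono ((integrable_const v).sub hi) (hX.inf (integrable_const v)) fun ω => ?_
        by_cases h : X ω ≤ a
        · simp [Set.indicator, h, h0 ω, hv]
        · simp [Set.indicator, h, hva.trans (not_le.mp h).le]

/-- If each `C i` satisfies the `(ε,δ)`-lower deviation inequality and
`R ≤ (1-ε) Z`, then the mean-weighted allocation has fairness
`Q(v) = max_{i,j} |q (v i) (C i) - q (v j) (C j)| ≤ (1-ε) δ`. -/
theorem meanWeighted_fairness_lowR
    {Ω : Type*} [MeasureSpace Ω] [IsProbabilityMeasure (ℙ : Measure Ω)]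
    {K : ℕ} (hK : 0 < K)
    (C : Fin K → Ω → ℝ)
    (hmeas : ∀ i, Measurable (C i))
    (hint : ∀ i, Integrable (C i))
    (hnonneg : ∀ i, ∀ ω, 0 ≤ C i ω)
    (μ : Fin K → ℝ) (hμ : ∀ i, μ i = ∫ ω, C i ω) (hμpos : ∀ i, 0 < μ i)
    (ε δ : ℝ) (hε0 : 0 < ε) (hε1 : ε < 1) (hδ0 : 0 < δ) (hδ1 : δ < 1)
    (hLD : ∀ i, (ℙ {ω | C i ω ≤ (1 - ε) * μ i}).toReal ≤ δ)
    (R : ℝ) (hR : 0 < R)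
    (Z : ℝ) (hZ : Z = ∑ i, μ i)
    (hRZ : R ≤ (1 - ε) * Z)
    (v : Fin K → ℝ) (hv : ∀ i, v i = R * μ i / Z) :
    ∀ i j, |(∫ ω, min (C i ω) (v i)) / μ i - (∫ ω, min (C j ω) (v j)) / μ j|
      ≤ (1 - ε) * δ := by
  have hZpos : 0 < Z := hZ ▸ Finset.sum_pos (fun i _ => hμpos i) ⟨⟨0, hK⟩, Finset.mem_univ _⟩
  have ht : R / Z ≤ 1 - ε := (div_le_iff₀ hZpos).2 hRZ
  have hv' : ∀ i, v i = R / Z * μ i := fun i => by rw [hv i]; ring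
  have hupper : ∀ i, (∫ ω, min (C i ω) (v i)) / μ i ≤ R / Z := fun i => by
    rw [div_le_iff₀ (hμpos i), ← hv' i]
    exact integral_min_const_le (hint i) (v i)
  have hlower : ∀ i, R / Z * (1 - δ) ≤ (∫ ω, min (C i ω) (v i)) / μ i := fun i => by
    rw [le_div_iff₀ (hμpos i), mul_right_comm, ← hv' i]
    refine mul_one_sub_le_integral_min_const (hmeas i) (hint i) (hnonneg i) ?_ ?_ (hLD i)
    · rw [hv' i]
      exact mul_nonneg (div_pos hR hZpos).le (hμpos i).le
    · rw [hv' i]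
      exact mul_le_mul_of_nonneg_right ht (hμpos i).le
  intro i j
  have hδt : R / Z * δ ≤ (1 - ε) * δ := mul_le_mul_of_nonneg_right ht hδ0.le
  rw [abs_le]
  constructor <;> linarith [hupper i, hupper j, hlower i, hlower j]
end

section
/- Suppose each C_i satisfies the (ε,δ)-lower deviation inequality and R ≥ (1−ε)Z. Then the mean-weighted allocation v_i = R·μ_i/Z satisfies, for every group i: (1−ε)(1−δ) ≤ q(v_i, C_i) ≤ 1. -/
open MeasureTheory ProbabilityTheory

/-- Markov-type lower bound for a truncated expectation: if `X ≥ 0` and `X ≤ a` with probability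
at most `δ`, then `E[min X v] ≥ a (1 - δ)` whenever `0 ≤ a ≤ v`. -/
theorem mul_one_sub_le_integral_min {Ω : Type*} [MeasurableSpace Ω] {P : Measure Ω}
    [IsProbabilityMeasure P] {X : Ω → ℝ} (hX : Measurable X) (hint : Integrable X P)
    (hnonneg : ∀ ω, 0 ≤ X ω) {a v δ : ℝ} (ha : 0 ≤ a) (hav : a ≤ v)
    (hδ : P.real {ω | X ω ≤ a} ≤ δ) :
    a * (1 - δ) ≤ ∫ ω, min (X ω) v ∂P := by
  have hs : MeasurableSet {ω | X ω ≤ a} := measurableSet_le hX measurable_const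
  calc a * (1 - δ) ≤ a * P.real {ω | X ω ≤ a}ᶜ := by
        rw [probReal_compl_eq_one_sub hs]
        gcongr
    _ = ∫ ω, {ω | X ω ≤ a}ᶜ.indicator (fun _ => a) ω ∂P := by
        rw [integral_indicator_const a hs.compl, smul_eq_mul, mul_comm]
    _ ≤ ∫ ω, min (X ω) v ∂P := by
        refine integral_mono ((integrable_const a).indicator hs.compl)
          (hint.inf (integrable_const v)) fun ω => ?_
        refine Set.indicator_apply_le' (fun hω => ?_) fun _ =>
          le_min (hnonneg ω) (ha.trans hav)
        exact le_min (le_of_not_ge (Set.notMem_of_mem_compl hω)) hav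

/-- If each `C i` satisfies the `(ε,δ)`-lower deviation inequality and
`R ≥ (1-ε) Z`, then the mean-weighted allocation `v i = R * μ i / Z` satisfies, for every `i`,
`(1-ε)(1-δ) ≤ q (v i) (C i) ≤ 1`. -/
theorem meanWeighted_availability_bounds_highR
    {Ω : Type*} [MeasureSpace Ω] [IsProbabilityMeasure (ℙ : Measure Ω)]
    {K : ℕ} (hK : 0 < K)
    (C : Fin K → Ω → ℝ)
    (hmeas : ∀ i, Measurable (C i))
    (hint : ∀ i, Integrable (C i))
    (hnonneg : ∀ i, ∀ ω, 0 ≤ C i ω)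
    (μ : Fin K → ℝ) (hμ : ∀ i, μ i = ∫ ω, C i ω) (hμpos : ∀ i, 0 < μ i)
    (ε δ : ℝ) (hε0 : 0 < ε) (hε1 : ε < 1) (hδ0 : 0 < δ) (hδ1 : δ < 1)
    (hLD : ∀ i, (ℙ {ω | C i ω ≤ (1 - ε) * μ i}).toReal ≤ δ)
    (R : ℝ) (hR : 0 < R)
    (Z : ℝ) (hZ : Z = ∑ i, μ i)
    (hRZ : (1 - ε) * Z ≤ R)
    (v : Fin K → ℝ) (hv : ∀ i, v i = R * μ i / Z) :
    ∀ i, (1 - ε) * (1 - δ) ≤ (∫ ω, min (C i ω) (v i)) / μ i ∧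
      (∫ ω, min (C i ω) (v i)) / μ i ≤ 1 := by
  intro i
  have hZpos : 0 < Z := hZ ▸ Finset.sum_pos (fun j _ => hμpos j) ⟨i, Finset.mem_univ i⟩
  have hav : (1 - ε) * μ i ≤ v i := by
    rw [hv, le_div_iff₀ hZpos]
    nlinarith [mul_le_mul_of_nonneg_right hRZ (hμpos i).le]
  constructor
  · rw [le_div_iff₀ (hμpos i), mul_right_comm]
    exact mul_one_sub_le_integral_min (hmeas i) (hint i) (hnonneg i)
      (mul_nonneg (sub_nonneg.mpr hε1.le) (hμpos i).le) hav (hLD i)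
  · rw [div_le_one (hμpos i), hμ i]
    exact integral_mono ((hint i).inf (integrable_const (v i))) (hint i)
      fun ω => min_le_left _ _
end

section
/- Suppose each C_i satisfies the (ε,δ)-lower deviation inequality, where ε + δ < 1, and let α be such that ε + δ ≤ α < 1. Then the Price of Fairness at level α is at most 1/(1−α); concretely, the mean-weighted allocation v = (R·μ_1/Z, …, R·μ_K/Z) satisfies Σ_i v_i = R, is α-fair (Q(v) ≤ α), and for every allocation w with w_i ≥ 0 and Σ_i w_i = R it holds that U(w) ≤ U(v)/(1−α). -/
open MeasureTheory ProbabilityTheory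

/-- If `P[X ≤ a] ≤ δ` then `E[min(X, v)] ≥ (1 - δ) min(a, v)`. -/
theorem one_sub_mul_min_le_integral_min {Ω : Type*} [MeasurableSpace Ω] {P : Measure Ω}
    [IsProbabilityMeasure P] {X : Ω → ℝ} (hX : Measurable X) (hint : Integrable X P)
    (hnonneg : ∀ ω, 0 ≤ X ω) {a v δ : ℝ} (ha : 0 ≤ a) (hv : 0 ≤ v)
    (hdev : P.real {ω | X ω ≤ a} ≤ δ) :
    (1 - δ) * min a v ≤ ∫ ω, min (X ω) v ∂P := by
  have hmarkov := mul_meas_ge_le_integral_of_nonneg (μ := P) (f := fun ω => min (X ω) v)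
    (.of_forall fun ω => le_min (hnonneg ω) hv) (hint.inf (integrable_const v)) (min a v)
  have hcompl := probReal_compl_eq_one_sub (μ := P) (measurableSet_le hX (measurable_const (a := a)))
  have hmono : P.real {ω | X ω ≤ a}ᶜ ≤ P.real {ω | min a v ≤ min (X ω) v} :=
    measureReal_mono fun ω hω => min_le_min_right v (le_of_not_ge hω)
  have hmin : 0 ≤ min a v := le_min ha hv
  nlinarith [mul_le_mul_of_nonneg_left hmono hmin, mul_le_mul_of_nonneg_left hdev hmin]

theorem integral_min_le_integral {Ω : Type*} [MeasurableSpace Ω] {P : Measure Ω}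
    [IsProbabilityMeasure P] {X : Ω → ℝ} (hint : Integrable X P) (v : ℝ) :
    ∫ ω, min (X ω) v ∂P ≤ ∫ ω, X ω ∂P :=
  integral_mono (hint.inf (integrable_const v)) hint fun _ => min_le_left _ _

theorem integral_min_le_const {Ω : Type*} [MeasurableSpace Ω] {P : Measure Ω}
    [IsProbabilityMeasure P] {X : Ω → ℝ} (hint : Integrable X P) (v : ℝ) :
    ∫ ω, min (X ω) v ∂P ≤ v := by
  simpa using integral_mono (hint.inf (integrable_const v)) (integrable_const v)
    fun ω => min_le_right (X ω) v

/-- If each `C i` satisfies the `(ε,δ)`-lower deviation inequality with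
`ε + δ < 1`, and `ε + δ ≤ α < 1`, then the mean-weighted allocation `v i = R * μ i / Z`
sums to `R`, is `α`-fair, and every allocation `w` with `w i ≥ 0` and `∑ i, w i = R`
has utilization `U(w) ≤ U(v) / (1-α)`; in particular the Price of Fairness at level `α`
is at most `1/(1-α)`. -/
theorem meanWeighted_PoF_one_div
    {Ω : Type*} [MeasureSpace Ω] [IsProbabilityMeasure (ℙ : Measure Ω)]
    {K : ℕ} (hK : 0 < K)
    (C : Fin K → Ω → ℝ)
    (hmeas : ∀ i, Measurable (C i))
    (hint : ∀ i, Integrable (C i))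
    (hnonneg : ∀ i, ∀ ω, 0 ≤ C i ω)
    (μ : Fin K → ℝ) (hμ : ∀ i, μ i = ∫ ω, C i ω) (hμpos : ∀ i, 0 < μ i)
    (ε δ : ℝ) (hε0 : 0 < ε) (hε1 : ε < 1) (hδ0 : 0 < δ) (hδ1 : δ < 1)
    (hεδ : ε + δ < 1)
    (hLD : ∀ i, (ℙ {ω | C i ω ≤ (1 - ε) * μ i}).toReal ≤ δ)
    (α : ℝ) (hα : ε + δ ≤ α) (hα1 : α < 1)
    (R : ℝ) (hR : 0 < R)
    (Z : ℝ) (hZ : Z = ∑ i, μ i)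
    (v : Fin K → ℝ) (hv : ∀ i, v i = R * μ i / Z) :
    (∑ i, v i = R) ∧
    (∀ i j, |(∫ ω, min (C i ω) (v i)) / μ i - (∫ ω, min (C j ω) (v j)) / μ j| ≤ α) ∧
    (∀ w : Fin K → ℝ, (∀ i, 0 ≤ w i) → ∑ i, w i = R →
      (∑ i, ∫ ω, min (C i ω) (w i)) ≤ (∑ i, ∫ ω, min (C i ω) (v i)) / (1 - α)) := by
  have : NeZero K := ⟨hK.ne'⟩
  have hZpos : 0 < Z := hZ ▸ Finset.sum_pos (fun i _ => hμpos i) Finset.univ_nonempty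
  set s := min (R / Z) 1 with hs
  have hs0 : 0 ≤ s := le_min (by positivity) zero_le_one
  have hs1 : s ≤ 1 := min_le_right _ _
  have hst : s ≤ R / Z := min_le_left _ _
  have hvt : ∀ i, v i = R / Z * μ i := fun i => by rw [hv]; ring
  have hupper : ∀ i, ∫ ω, min (C i ω) (v i) ≤ s * μ i := fun i => by
    rw [hs, min_mul_of_nonneg _ _ (hμpos i).le, one_mul, ← hvt]
    exact le_min (integral_min_le_const (hint i) _)
      ((integral_min_le_integral (hint i) _).trans_eq (hμ i).symm)
  have hlower : ∀ i, (1 - α) * (s * μ i) ≤ ∫ ω, min (C i ω) (v i) := fun i => by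
    have hμi := hμpos i
    have hsμ : 0 ≤ s * μ i := mul_nonneg hs0 hμi.le
    have hmin : (1 - ε) * (s * μ i) ≤ min ((1 - ε) * μ i) (v i) := by
      refine le_min ?_ ?_
      · gcongr
        exact mul_le_of_le_one_left hμi.le hs1
      · rw [hvt]
        exact (mul_le_of_le_one_left hsμ (by linarith)).trans (by gcongr)
    have hv0 : 0 ≤ v i := by rw [hvt]; positivity
    have hdev := one_sub_mul_min_le_integral_min (hmeas i) (hint i) (hnonneg i)
      (mul_nonneg (sub_nonneg.mpr hε1.le) hμi.le) hv0 (hLD i)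
    refine le_trans ?_ hdev
    calc (1 - α) * (s * μ i) ≤ (1 - δ) * (1 - ε) * (s * μ i) := by
          gcongr
          nlinarith [mul_pos hε0 hδ0]
      _ = (1 - δ) * ((1 - ε) * (s * μ i)) := by ring
      _ ≤ _ := by
          gcongr
  refine ⟨?_, fun i j => ?_, fun w _ hw => ?_⟩
  · simp_rw [hvt]
    rw [← Finset.mul_sum, ← hZ, div_mul_cancel₀ _ hZpos.ne']
  · have hq : ∀ i, (1 - α) * s ≤ (∫ ω, min (C i ω) (v i)) / μ i ∧
        (∫ ω, min (C i ω) (v i)) / μ i ≤ s := fun i =>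
      ⟨(le_div_iff₀ (hμpos i)).mpr (by rw [mul_assoc]; exact hlower i),
        (div_le_iff₀ (hμpos i)).mpr (hupper i)⟩
    have hαs : α * s ≤ α := mul_le_of_le_one_right (by linarith) hs1
    obtain ⟨hi, hi'⟩ := hq i
    obtain ⟨hj, hj'⟩ := hq j
    exact abs_sub_le_iff.mpr ⟨by linarith, by linarith⟩
  · rw [le_div_iff₀ (by linarith), mul_comm]
    have hU : ∑ i, ∫ ω, min (C i ω) (w i) ≤ s * Z := by
      rw [hs, min_mul_of_nonneg _ _ hZpos.le, one_mul, div_mul_cancel₀ _ hZpos.ne']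
      refine le_min ?_ ?_
      · exact (Finset.sum_le_sum fun i _ => integral_min_le_const (hint i) _).trans_eq hw
      · rw [hZ]
        exact Finset.sum_le_sum fun i _ =>
          (integral_min_le_integral (hint i) _).trans_eq (hμ i).symm
    calc (1 - α) * ∑ i, ∫ ω, min (C i ω) (w i) ≤ (1 - α) * (s * Z) := by
          gcongr
      _ = ∑ i, (1 - α) * (s * μ i) := by rw [hZ, ← Finset.mul_sum, ← Finset.mul_sum]
      _ ≤ _ := Finset.sum_le_sum fun i _ => hlower i
end
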